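/- Expansion of the product of the Gaussian theta series and the q-Hermite weight function: for every complex number w with 0 < |w| < 1 and every nonzero complex number x, ( Σ_{a∈ℤ} w^{3a²} xᵃ ) · ∏_{j=0}^{∞} (1 − w^{12j} x²)(1 − w^{12j+12} x^{-2}) = Σ_{m=0}^{∞} (−1)^m [ w^{3m(3m+2)} ( x^{−3m} − x^{3m+2} ) + w^{3(3m+1)(m+1)} ( x^{−3m−1} − x^{3m+3} ) ], where all series converge absolutely and the infinite product converges. (With q = w^{12}, the left-hand side is γ̃'(x)·μ̄(x;q) for the theta function γ̃' = Σ q^{a²/4}xᵃ and μ̄ = ∏_{j≥0}(1−q^jx²)(1−q^{j+1}x^{-2}); the right-hand side runs over n ≥ 0 with n ≢ 2 mod 3, with coefficients ±q^{n(n+2)/12}.) -/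

import Mathlib

open Filter Topology

namespace ThetaHermite

lemma summable_gauss (u v : ℂ) (hu0 : u ≠ 0) (hu1 : ‖u‖ < 1) (hv : v ≠ 0) :
    Summable (fun a : ℤ => ‖u ^ (a ^ 2) * v ^ a‖) := by
  have key : ∀ v : ℂ, v ≠ 0 → Summable (fun n : ℕ => ‖u ^ (n ^ 2) * v ^ n‖) := by
    intro v hv
    have hlt : Tendsto (fun n : ℕ => ‖u‖ ^ (2 * n + 1) * ‖v‖) atTop (𝓝 0) := by
      have h1 : Tendsto (fun n : ℕ => ‖u‖ ^ (2 * n + 1)) atTop (𝓝 0) :=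
        (tendsto_pow_atTop_nhds_zero_of_lt_one (norm_nonneg _) hu1).comp
          (tendsto_atTop_mono (fun n => by simp only [id]; omega) tendsto_id)
      simpa using h1.mul_const ‖v‖
    refine summable_of_ratio_test_tendsto_lt_one (l := 0) one_pos ?_ ?_
    · exact Eventually.of_forall fun n => by simp [hu0, hv]
    · refine hlt.congr fun n => ?_
      have h1 : ‖u‖ ≠ 0 := by simpa using hu0
      have h2 : ‖v‖ ≠ 0 := by simpa using hv
      simp only [norm_mul, norm_pow, norm_norm]
      rw [eq_div_iff (by positivity)]
      ring
  refine Summable.of_nat_of_neg ?_ ?_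
  · refine (key v hv).congr fun n => ?_
    norm_cast
  · refine (key v⁻¹ (inv_ne_zero hv)).congr fun n => ?_
    rw [neg_sq, zpow_neg, inv_pow, zpow_natCast]
    norm_cast

/-- partial products of `(q;q)` -/
noncomputable def Q (q : ℂ) (n : ℕ) : ℂ := ∏ i ∈ Finset.range n, (1 - q ^ (i + 1))

noncomputable def Phi (q : ℂ) : ℂ := ∏' i : ℕ, (1 - q ^ (i + 1))

/-- reciprocals of the partial products, extended by zero to negative integers -/
noncomputable def R (q : ℂ) (m : ℤ) : ℂ := if m < 0 then 0 else (Q q m.toNat)⁻¹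

lemma one_sub_ne (q : ℂ) (hq : ‖q‖ < 1) (i : ℕ) : 1 - q ^ (i + 1) ≠ 0 := by
  intro h
  have h1 : q ^ (i + 1) = 1 := (sub_eq_zero.mp h).symm
  have h2 : ‖q‖ ^ (i + 1) < 1 := pow_lt_one₀ (norm_nonneg _) hq (by omega)
  rw [← norm_pow, h1] at h2
  simp at h2

lemma Q_ne (q : ℂ) (hq : ‖q‖ < 1) (n : ℕ) : Q q n ≠ 0 :=
  Finset.prod_ne_zero_iff.mpr fun i _ => one_sub_ne q hq i

lemma summable_pow (q c : ℂ) (hq : ‖q‖ < 1) (b : ℕ) : Summable (fun i : ℕ => ‖-(q ^ (i + b) * c)‖) := by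
  have := (summable_geometric_of_lt_one (norm_nonneg q) hq).mul_right (‖q‖ ^ b * ‖c‖)
  refine this.congr fun i => ?_
  simp [pow_add]; ring

lemma multipliable_pow (q c : ℂ) (hq : ‖q‖ < 1) (b : ℕ) :
    Multipliable (fun i : ℕ => (1 - q ^ (i + b) * c)) := by
  simpa [sub_eq_add_neg] using multipliable_one_add_of_summable (summable_pow q c hq b)

lemma Phi_ne (q : ℂ) (hq : ‖q‖ < 1) : Phi q ≠ 0 := by
  have := tprod_one_add_ne_zero_of_summable (f := fun i : ℕ => -(q ^ (i + 1) * 1))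
    (fun i => by simpa [sub_eq_add_neg] using one_sub_ne q hq i) (summable_pow q 1 hq 1)
  simpa [Phi, sub_eq_add_neg] using this

lemma tendsto_Q (q : ℂ) (hq : ‖q‖ < 1) : Tendsto (Q q) atTop (𝓝 (Phi q)) := by
  have := (multipliable_pow q 1 hq 1).tendsto_prod_tprod_nat
  simp only [mul_one] at this
  exact this

lemma R_rec (q : ℂ) (hq : ‖q‖ < 1) (m : ℤ) : R q (m - 1) = (1 - q ^ m) * R q m := by
  rcases lt_trichotomy m 0 with h | h | h
  · simp [R, h, show m - 1 < 0 by omega]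
  · subst h; simp [R]
  · obtain ⟨k, rfl⟩ : ∃ k : ℕ, m = k + 1 := ⟨(m - 1).toNat, by omega⟩
    have e : ((k : ℤ) + 1).toNat = k + 1 := by omega
    have h1 := one_sub_ne q hq k
    have h2 := Q_ne q hq k
    simp only [R, add_sub_cancel_right, e, Int.toNat_natCast, show ¬ ((k : ℤ) < 0) by omega,
      show ¬ ((k : ℤ) + 1 < 0) by omega, if_false]
    have e2 : Q q (k + 1) = Q q k * (1 - q ^ (k + 1)) := by simp [Q, Finset.prod_range_succ]
    rw [e2]
    have e3 : q ^ ((k : ℤ) + 1) = q ^ (k + 1) := by norm_cast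
    rw [e3]
    field_simp

lemma tendsto_R (q : ℂ) (hq : ‖q‖ < 1) : Tendsto (R q) atTop (𝓝 (Phi q)⁻¹) := by
  have h1 : Tendsto (fun m : ℤ => (Q q m.toNat)⁻¹) atTop (𝓝 (Phi q)⁻¹) := by
    refine ((tendsto_Q q hq).inv₀ (Phi_ne q hq)).comp ?_
    refine tendsto_atTop.mpr fun b => ?_
    filter_upwards [eventually_ge_atTop (b : ℤ)] with m hm
    omega
  refine h1.congr' ?_
  filter_upwards [eventually_ge_atTop 0] with m hm
  simp [R, not_lt.mpr hm]

lemma bound_Q (q : ℂ) (hq : ‖q‖ < 1) : ∃ C, ∀ n, ‖Q q n‖ ≤ C := by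
  obtain ⟨C, hC⟩ := (tendsto_Q q hq).norm.bddAbove_range
  exact ⟨C, fun n => hC ⟨n, rfl⟩⟩

lemma bound_R (q : ℂ) (hq : ‖q‖ < 1) : ∃ C, 0 ≤ C ∧ ∀ m, ‖R q m‖ ≤ C := by
  obtain ⟨C, hC⟩ := ((tendsto_Q q hq).inv₀ (Phi_ne q hq)).norm.bddAbove_range
  have h0 : 0 ≤ C := (norm_nonneg _).trans (hC ⟨0, rfl⟩)
  refine ⟨C, h0, fun m => ?_⟩
  unfold R
  split_ifs
  · simpa using h0
  · exact hC ⟨m.toNat, rfl⟩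

/-- terms of the triple product series -/
noncomputable def t (r y : ℂ) (k : ℤ) : ℂ := (-1) ^ k * r ^ (k * (k - 1)) * y ^ k

lemma t_succ (r y : ℂ) (hr : r ≠ 0) (hy : y ≠ 0) (k : ℤ) :
    t r y (k + 1) = - ((r ^ 2) ^ k * y * t r y k) := by
  unfold t
  rw [show (k + 1) * (k + 1 - 1) = k * (k - 1) + 2 * k by ring, zpow_add₀ hr, zpow_add₀ hy,
    zpow_add₀ (by norm_num : (-1 : ℂ) ≠ 0), zpow_mul r 2 k, zpow_one, zpow_one, zpow_ofNat]
  ring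

lemma summable_t (r y : ℂ) (hr : r ≠ 0) (hr1 : ‖r‖ < 1) (hy : y ≠ 0) :
    Summable (fun k => ‖t r y k‖) := by
  refine (summable_gauss r (y / r) hr hr1 (div_ne_zero hy hr)).congr fun k => ?_
  unfold t
  rw [show k * (k - 1) = k ^ 2 - k by ring, zpow_sub₀ hr, div_zpow]
  simp
  ring

lemma finite_triple (r y : ℂ) (hr : r ≠ 0) (hr1 : ‖r‖ < 1) (hy : y ≠ 0) (n : ℕ) :
    HasSum (fun k : ℤ => Q (r ^ 2) (2 * n) * R (r ^ 2) (n + k) * R (r ^ 2) (n - k) * t r y k)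
      (∏ j ∈ Finset.range n, ((1 - (r ^ 2) ^ j * y) * (1 - (r ^ 2) ^ (j + 1) * y⁻¹))) := by
  have hq1 : ‖r ^ 2‖ < 1 := by
    rw [norm_pow]; exact pow_lt_one₀ (norm_nonneg _) hr1 (by norm_num)
  have hq : r ^ 2 ≠ 0 := pow_ne_zero _ hr
  induction n with
  | zero =>
    have := hasSum_single (f := fun k : ℤ => Q (r ^ 2) (2 * 0) * R (r ^ 2) ((0 : ℕ) + k)
      * R (r ^ 2) ((0 : ℕ) - k) * t r y k) 0 ?_
    · simpa [Q, R, t] using this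
    · intro k hk
      rcases lt_or_gt_of_ne hk with h | h
      · simp [R, h]
      · simp [R, h]
  | succ n ih =>
    have hs : ∀ k, t r y k = - ((r ^ 2) ^ (k - 1) * y * t r y (k - 1)) := fun k => by
      have := t_succ r y hr hy (k - 1); rwa [sub_add_cancel] at this
    have s1 := (Equiv.addRight (-1 : ℤ)).hasSum_iff.mpr ih
    have s2 := (Equiv.addRight (1 : ℤ)).hasSum_iff.mpr ih
    have := ((ih.mul_left (1 + (r ^ 2) ^ (2 * n + 1))).add
      (s1.mul_left (-((r ^ 2) ^ n * y)))).add (s2.mul_left (-((r ^ 2) ^ (n + 1) * y⁻¹)))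
    rw [Finset.prod_range_succ]
    convert this using 1
    · rfl
    · funext k
      simp only [Function.comp, Equiv.coe_addRight]
      set q := r ^ 2 with hqdef
      have e1 := R_rec q hq1 (n + 1 + k)
      have e2 := R_rec q hq1 (n + 1 - k)
      have e3 := R_rec q hq1 (n + 1 + k - 1)
      have e4 := R_rec q hq1 (n + 1 - k - 1)
      have eQ : Q q (2 * (n + 1)) = Q q (2 * n) * (1 - q ^ (2 * n + 1)) * (1 - q ^ (2 * n + 2)) := by
        rw [show 2 * (n + 1) = 2 * n + 1 + 1 by ring]
        simp [Q, Finset.prod_range_succ]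
      have ht1 : y * t r y (k + -1) = - (q * q ^ (-k) * t r y k) := by
        rw [hs k, zpow_sub₀ hq, zpow_neg, ← sub_eq_add_neg]
        have := zpow_ne_zero k hq
        field_simp
      have ht2 : y⁻¹ * t r y (k + 1) = - (q ^ k * t r y k) := by
        rw [t_succ r y hr hy, ← hqdef]; field_simp
      rw [show (n : ℤ) + k = n + 1 + k - 1 by ring, show (n : ℤ) - k = n + 1 - k - 1 by ring,
        show (n : ℤ) + (k + -1) = n + 1 + k - 1 - 1 by ring,
        show (n : ℤ) - (k + -1) = n + 1 - k by ring,
        show (n : ℤ) + (k + 1) = n + 1 + k by ring,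
        show (n : ℤ) - (k + 1) = n + 1 - k - 1 - 1 by ring, e3, e4, e1, e2, eQ]
      push_cast
      have z1 : q ^ ((n : ℤ) + 1 + k) = q ^ n * q * q ^ k := by
        rw [zpow_add₀ hq, zpow_add₀ hq]; simp
      have z2 : q ^ ((n : ℤ) + 1 - k) = q ^ n * q * (q ^ k)⁻¹ := by
        rw [zpow_sub₀ hq, zpow_add₀ hq]; simp [div_eq_mul_inv]
      have z3 : q ^ ((n : ℤ) + 1 + k - 1) = q ^ n * q ^ k := by
        rw [zpow_sub₀ hq, z1]; field_simp
      have z4 : q ^ ((n : ℤ) + 1 - k - 1) = q ^ n * (q ^ k)⁻¹ := by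
        rw [zpow_sub₀ hq, z2]; field_simp
      rw [z1, z2, z3, z4]
      rw [zpow_neg] at ht1
      generalize R q (n + 1 + k) = Ra
      generalize R q (n + 1 - k) = Rb
      generalize t r y k = T at *
      generalize t r y (k + 1) = Tp at *
      generalize t r y (k + -1) = Tm at *
      generalize Q q (2 * n) = Qn
      have hK := zpow_ne_zero k hq
      generalize q ^ k = K at *
      have hT1 : Tm = - (q * K⁻¹ * T) * y⁻¹ := by rw [← ht1]; field_simp
      have hT2 : Tp = - (K * T) * y := by rw [← ht2]; field_simp
      rw [hT1, hT2]
      simp only [pow_add, pow_mul', pow_one]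
      generalize q ^ n = N
      field_simp
      ring
    · generalize ∏ j ∈ Finset.range n, ((1 - (r ^ 2) ^ j * y) * (1 - (r ^ 2) ^ (j + 1) * y⁻¹)) = A
      field_simp
      ring

lemma triple (r y : ℂ) (hr : r ≠ 0) (hr1 : ‖r‖ < 1) (hy : y ≠ 0) :
    Tendsto (fun n => ∏ j ∈ Finset.range n, ((1 - (r ^ 2) ^ j * y) * (1 - (r ^ 2) ^ (j + 1) * y⁻¹)))
      atTop (𝓝 ((Phi (r ^ 2))⁻¹ * ∑' k, t r y k)) := by
  have hq1 : ‖r ^ 2‖ < 1 := by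
    rw [norm_pow]; exact pow_lt_one₀ (norm_nonneg _) hr1 (by norm_num)
  have hP := Phi_ne _ hq1
  obtain ⟨C, hC⟩ := bound_Q _ hq1
  obtain ⟨D, hD0, hD⟩ := bound_R _ hq1
  have hC0 : 0 ≤ C := (norm_nonneg _).trans (hC 0)
  rw [← tsum_mul_left]
  have := tendsto_tsum_of_dominated_convergence (𝓕 := atTop)
    (f := fun (n : ℕ) (k : ℤ) =>
      Q (r ^ 2) (2 * n) * R (r ^ 2) (n + k) * R (r ^ 2) (n - k) * t r y k)
    (g := fun k => (Phi (r ^ 2))⁻¹ * t r y k) (bound := fun k => C * D * D * ‖t r y k‖)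
    ((summable_t r y hr hr1 hy).mul_left _) ?_ ?_
  · refine this.congr fun n => (finite_triple r y hr hr1 hy n).tsum_eq
  · intro k
    have a1 : Tendsto (fun n : ℕ => Q (r ^ 2) (2 * n)) atTop (𝓝 (Phi (r ^ 2))) :=
      (tendsto_Q _ hq1).comp (tendsto_atTop_mono (fun n => by simp only [id]; omega) tendsto_id)
    have a2 : Tendsto (fun n : ℕ => R (r ^ 2) (n + k)) atTop (𝓝 (Phi (r ^ 2))⁻¹) :=
      (tendsto_R _ hq1).comp
        (tendsto_atTop_add_const_right _ _ tendsto_natCast_atTop_atTop)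
    have a3 : Tendsto (fun n : ℕ => R (r ^ 2) (n - k)) atTop (𝓝 (Phi (r ^ 2))⁻¹) :=
      (tendsto_R _ hq1).comp
        (tendsto_atTop_add_const_right _ (-k) tendsto_natCast_atTop_atTop)
    have := ((a1.mul a2).mul a3).mul_const (t r y k)
    rwa [mul_inv_cancel₀ hP, one_mul] at this
  · refine Eventually.of_forall fun n k => ?_
    simp only [norm_mul]
    gcongr
    · exact hC _
    · exact hD _
    · exact hD _

/-- pentagonal number theorem -/
lemma pentagonal_sum (r : ℂ) (hr : r ≠ 0) (hr1 : ‖r‖ < 1) :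
    ∑' k : ℤ, (-1 : ℂ) ^ k * r ^ (3 * k ^ 2 - k) = Phi (r ^ 2) := by
  have hq1 : ∀ m ≠ 0, ‖r ^ m‖ < 1 := fun m hm => by
    rw [norm_pow]; exact pow_lt_one₀ (norm_nonneg _) hr1 hm
  have h := triple (r ^ 3) (r ^ 2) (pow_ne_zero _ hr) (hq1 3 (by norm_num)) (pow_ne_zero _ hr)
  have h2 := h.mul (tendsto_Q ((r ^ 3) ^ 2) (by rw [← pow_mul]; exact hq1 _ (by norm_num)))
  have h3 : Tendsto (fun n : ℕ => Q (r ^ 2) (3 * n)) atTop (𝓝 (Phi (r ^ 2))) :=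
    (tendsto_Q _ (hq1 2 (by norm_num))).comp
      (tendsto_atTop_mono (fun n => by simp only [id]; omega) tendsto_id)
  have hP := Phi_ne ((r ^ 3) ^ 2) (by rw [← pow_mul]; exact hq1 _ (by norm_num))
  have e : ∀ n, (∏ j ∈ Finset.range n, ((1 - ((r ^ 3) ^ 2) ^ j * r ^ 2) *
      (1 - ((r ^ 3) ^ 2) ^ (j + 1) * (r ^ 2)⁻¹))) * Q ((r ^ 3) ^ 2) n = Q (r ^ 2) (3 * n) := by
    intro n
    induction n with
    | zero => simp [Q]
    | succ n ih =>
      rw [show 3 * (n + 1) = 3 * n + 1 + 1 + 1 by ring]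
      unfold Q at ih ⊢
      rw [Finset.prod_range_succ, Finset.prod_range_succ, Finset.prod_range_succ,
        Finset.prod_range_succ, Finset.prod_range_succ, ← ih]
      have : ((r ^ 3) ^ 2) ^ (n + 1) * (r ^ 2)⁻¹ = r ^ (6 * n + 4) := by
        field_simp
        ring
      rw [this]
      ring
  have h4 := tendsto_nhds_unique (h2.congr e) h3
  rw [← h4, mul_comm, mul_inv_cancel_left₀ hP]
  refine tsum_congr fun k => ?_
  unfold t
  rw [mul_assoc, ← zpow_natCast r 3, ← zpow_natCast r 2, ← zpow_mul, ← zpow_mul, ← zpow_add₀ hr]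
  congr 2
  push_cast
  ring

lemma inner0 (w x : ℂ) (hw : w ≠ 0) (hw1 : ‖w‖ < 1) (hx : x ≠ 0) (m : ℤ) :
    ∑' k : ℤ, (w ^ (3 * (3 * m - 2 * k) ^ 2) * x ^ (3 * m - 2 * k)) * t (w ^ 6) (x ^ 2) k
      = (-1) ^ m * w ^ (9 * m ^ 2 - 6 * m) * x ^ (3 * m) * Phi ((w ^ 6) ^ 2) := by
  rw [← pentagonal_sum (w ^ 6) (pow_ne_zero _ hw)
    (by rw [norm_pow]; exact pow_lt_one₀ (norm_nonneg _) hw1 (by norm_num)), ← tsum_mul_left,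
    ← (Equiv.addRight m).tsum_eq]
  refine tsum_congr fun k => ?_
  simp only [Equiv.coe_addRight, t]
  rw [← zpow_natCast w 6, ← zpow_natCast x 2, ← zpow_mul, ← zpow_mul, ← zpow_mul,
    zpow_add₀ (by norm_num : (-1 : ℂ) ≠ 0)]
  calc _ = (-1) ^ k * (-1) ^ m * (w ^ (3 * (3 * m - 2 * (k + m)) ^ 2)
        * w ^ (((6 : ℕ) : ℤ) * ((k + m) * (k + m - 1))))
        * (x ^ (3 * m - 2 * (k + m)) * x ^ (((2 : ℕ) : ℤ) * (k + m))) := by ring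
    _ = (-1) ^ k * (-1) ^ m * (w ^ (9 * m ^ 2 - 6 * m) * w ^ (((6 : ℕ) : ℤ) * (3 * k ^ 2 - k)))
        * x ^ (3 * m) := by
      rw [← zpow_add₀ hw, ← zpow_add₀ hx, ← zpow_add₀ hw]
      congr 2
      · congr 1
        push_cast
        ring
      · push_cast
        ring
    _ = _ := by ring

lemma inner2 (w x : ℂ) (hw : w ≠ 0) (hw1 : ‖w‖ < 1) (hx : x ≠ 0) (m : ℤ) :
    ∑' k : ℤ, (w ^ (3 * (3 * m + 2 - 2 * k) ^ 2) * x ^ (3 * m + 2 - 2 * k)) * t (w ^ 6) (x ^ 2) k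
      = -((-1) ^ m * w ^ (9 * m ^ 2 + 6 * m) * x ^ (3 * m + 2)) * Phi ((w ^ 6) ^ 2) := by
  rw [← pentagonal_sum (w ^ 6) (pow_ne_zero _ hw)
    (by rw [norm_pow]; exact pow_lt_one₀ (norm_nonneg _) hw1 (by norm_num)), ← tsum_mul_left,
    ← (Equiv.subLeft (m + 1)).tsum_eq]
  refine tsum_congr fun k => ?_
  simp only [Equiv.subLeft_apply, t]
  have hs : (-1 : ℂ) ^ (m + 1 - k) = - ((-1) ^ k * (-1) ^ m) := by
    rw [zpow_sub₀ (by norm_num : (-1 : ℂ) ≠ 0), zpow_add₀ (by norm_num : (-1 : ℂ) ≠ 0),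
      div_eq_mul_inv, ← inv_zpow]
    norm_num
    ring
  rw [← zpow_natCast w 6, ← zpow_natCast x 2, ← zpow_mul, ← zpow_mul, ← zpow_mul, hs]
  calc _ = -((-1) ^ k * (-1) ^ m) * (w ^ (3 * (3 * m + 2 - 2 * (m + 1 - k)) ^ 2)
        * w ^ (((6 : ℕ) : ℤ) * ((m + 1 - k) * (m + 1 - k - 1))))
        * (x ^ (3 * m + 2 - 2 * (m + 1 - k)) * x ^ (((2 : ℕ) : ℤ) * (m + 1 - k))) := by ring
    _ = -((-1) ^ k * (-1) ^ m) * (w ^ (9 * m ^ 2 + 6 * m) * w ^ (((6 : ℕ) : ℤ) * (3 * k ^ 2 - k)))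
        * x ^ (3 * m + 2) := by
      rw [← zpow_add₀ hw, ← zpow_add₀ hx, ← zpow_add₀ hw]
      congr 2
      · congr 1
        push_cast
        ring
      · push_cast
        ring
    _ = _ := by ring

lemma inner1 (w x : ℂ) (hw : w ≠ 0) (hx : x ≠ 0) (m : ℤ) :
    ∑' k : ℤ, (w ^ (3 * (3 * m + 1 - 2 * k) ^ 2) * x ^ (3 * m + 1 - 2 * k)) * t (w ^ 6) (x ^ 2) k
      = 0 := by
  rw [← CharZero.eq_neg_self_iff, ← tsum_neg]
  conv_lhs => rw [← (Equiv.subLeft (2 * m + 1)).tsum_eq]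
  refine tsum_congr fun k => ?_
  simp only [Equiv.subLeft_apply, t]
  have hs : (-1 : ℂ) ^ (2 * m + 1 - k) = - ((-1) ^ k) := by
    rw [zpow_sub₀ (by norm_num : (-1 : ℂ) ≠ 0), zpow_add₀ (by norm_num : (-1 : ℂ) ≠ 0),
      div_eq_mul_inv, ← inv_zpow, zpow_mul]
    norm_num
  rw [← zpow_natCast w 6, ← zpow_natCast x 2, ← zpow_mul, ← zpow_mul, ← zpow_mul, ← zpow_mul, hs]
  calc _ = -((-1) ^ k) * (w ^ (3 * (3 * m + 1 - 2 * (2 * m + 1 - k)) ^ 2)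
        * w ^ (((6 : ℕ) : ℤ) * ((2 * m + 1 - k) * (2 * m + 1 - k - 1))))
        * (x ^ (3 * m + 1 - 2 * (2 * m + 1 - k)) * x ^ (((2 : ℕ) : ℤ) * (2 * m + 1 - k))) := by ring
    _ = -((-1) ^ k) * (w ^ (3 * (3 * m + 1 - 2 * k) ^ 2)
        * w ^ (((6 : ℕ) : ℤ) * (k * (k - 1))))
        * (x ^ (3 * m + 1 - 2 * k) * x ^ (((2 : ℕ) : ℤ) * k)) := by
      rw [← zpow_add₀ hw, ← zpow_add₀ hx, ← zpow_add₀ hw, ← zpow_add₀ hx]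
      congr 2
      · congr 1
        push_cast
        ring
      · push_cast
        ring
    _ = _ := by ring

/-- the shear `(n, k) ↦ (n - 2k, k)` -/
def shear : ℤ × ℤ ≃ ℤ × ℤ where
  toFun p := (p.1 - 2 * p.2, p.2)
  invFun p := (p.1 + 2 * p.2, p.2)
  left_inv p := by simp
  right_inv p := by simp

lemma summable_theta (w x : ℂ) (hw : w ≠ 0) (hw1 : ‖w‖ < 1) (hx : x ≠ 0) :
    Summable (fun a : ℤ => ‖w ^ (3 * a ^ 2) * x ^ a‖) := by
  refine (summable_gauss (w ^ 3) x (pow_ne_zero _ hw)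
    (by rw [norm_pow]; exact pow_lt_one₀ (norm_nonneg _) hw1 (by norm_num)) hx).congr fun a => ?_
  rw [zpow_mul, zpow_ofNat]

lemma main_hasSum (w x : ℂ) (hw : w ≠ 0) (hw1 : ‖w‖ < 1) (hx : x ≠ 0) :
    HasSum (fun m : ℤ => (-1) ^ m * w ^ (9 * m ^ 2 - 6 * m) * x ^ (3 * m)
        - (-1) ^ m * w ^ (9 * m ^ 2 + 6 * m) * x ^ (3 * m + 2))
      ((∑' a : ℤ, w ^ (3 * a ^ 2) * x ^ a) *
        ((Phi ((w ^ 6) ^ 2))⁻¹ * ∑' k, t (w ^ 6) (x ^ 2) k)) := by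
  have h6 : ‖w ^ 6‖ < 1 := by
    rw [norm_pow]; exact pow_lt_one₀ (norm_nonneg _) hw1 (by norm_num)
  have hP := Phi_ne ((w ^ 6) ^ 2)
    (by rw [norm_pow]; exact pow_lt_one₀ (norm_nonneg _) h6 (by norm_num))
  have s1 := summable_theta w x hw hw1 hx
  have s2 := summable_t (w ^ 6) (x ^ 2) (pow_ne_zero _ hw) h6 (pow_ne_zero _ hx)
  have hF := (summable_mul_of_summable_norm s1 s2).hasSum
  rw [← tsum_mul_tsum_of_summable_norm s1 s2, ← shear.hasSum_iff] at hF
  have hn := hF.prod_fiberwise fun n => (hF.summable.prod_factor n).hasSum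
  rw [← (Int.divModEquiv 3).symm.hasSum_iff] at hn
  have hm := (hn.prod_fiberwise fun m => hasSum_fintype _).mul_left (Phi ((w ^ 6) ^ 2))⁻¹
  convert hm using 1
  · rfl
  · funext m
    rw [Fin.sum_univ_three]
    simp only [Function.comp, Int.divModEquiv_symm_apply, shear, Equiv.coe_fn_mk]
    have a0 := inner0 w x hw hw1 hx m
    have a1 := inner1 w x hw hx m
    have a2 := inner2 w x hw hw1 hx m
    rw [show m * ((3 : ℕ) : ℤ) + ((0 : Fin 3) : ℕ) = 3 * m by simp; ring,
      show m * ((3 : ℕ) : ℤ) + ((1 : Fin 3) : ℕ) = 3 * m + 1 by simp; ring,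
      show m * ((3 : ℕ) : ℤ) + ((2 : Fin 3) : ℕ) = 3 * m + 2 by simp; ring, a0, a1, a2]
    generalize Phi ((w ^ 6) ^ 2) = P at *
    field_simp
    ring
  · ring

lemma final_hasSum (w x : ℂ) (hw : w ≠ 0) (hw1 : ‖w‖ < 1) (hx : x ≠ 0) :
    Summable (fun m : ℕ =>
      ‖(-1 : ℂ) ^ m * (w ^ (3 * m * (3 * m + 2)) * (x ^ (-(3 * (m : ℤ))) - x ^ (3 * (m : ℤ) + 2))
        + w ^ (3 * (3 * m + 1) * (m + 1)) * (x ^ (-(3 * (m : ℤ)) - 1) - x ^ (3 * (m : ℤ) + 3)))‖) ∧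
    HasSum (fun m : ℕ =>
      (-1 : ℂ) ^ m * (w ^ (3 * m * (3 * m + 2)) * (x ^ (-(3 * (m : ℤ))) - x ^ (3 * (m : ℤ) + 2))
        + w ^ (3 * (3 * m + 1) * (m + 1)) * (x ^ (-(3 * (m : ℤ)) - 1) - x ^ (3 * (m : ℤ) + 3))))
      ((∑' a : ℤ, w ^ (3 * a ^ 2) * x ^ a) *
        ((Phi ((w ^ 6) ^ 2))⁻¹ * ∑' k, t (w ^ 6) (x ^ 2) k)) := by
  have h9 : ‖w ^ 9‖ < 1 := by
    rw [norm_pow]; exact pow_lt_one₀ (norm_nonneg _) hw1 (by norm_num)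
  let H1 : ℤ → ℂ := fun j => (-1) ^ j * w ^ (9 * j ^ 2 + 6 * j) * x ^ (-(3 * j))
  let H2 : ℤ → ℂ := fun j => (-1) ^ j * w ^ (9 * j ^ 2 + 6 * j) * x ^ (3 * j + 2)
  have n1 : Summable (fun j => ‖H1 j‖) := by
    refine (summable_gauss (w ^ 9) (w ^ 6 * (x ^ 3)⁻¹) (pow_ne_zero _ hw) h9
      (mul_ne_zero (pow_ne_zero _ hw) (inv_ne_zero (pow_ne_zero _ hx)))).congr fun j => ?_
    simp only [H1]
    rw [zpow_add₀ hw, zpow_neg, mul_zpow, inv_zpow, zpow_mul w, zpow_mul w, zpow_mul x,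
      zpow_ofNat, zpow_ofNat, zpow_ofNat]
    simp [mul_assoc]
  have n2 : Summable (fun j => ‖H2 j‖) := by
    refine ((summable_gauss (w ^ 9) (w ^ 6 * x ^ 3) (pow_ne_zero _ hw) h9
      (mul_ne_zero (pow_ne_zero _ hw) (pow_ne_zero _ hx))).mul_right ‖x ^ 2‖).congr fun j => ?_
    simp only [H2]
    rw [zpow_add₀ hw, zpow_add₀ hx, mul_zpow, zpow_mul w, zpow_mul w, zpow_mul x,
      zpow_ofNat, zpow_ofNat, zpow_ofNat, zpow_ofNat]
    simp [mul_assoc]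
  have s1 : Summable H1 := n1.of_norm
  have s2 : Summable H2 := n2.of_norm
  have hM := main_hasSum w x hw hw1 hx
  have s1' := (Equiv.neg ℤ).hasSum_iff.mpr s1.hasSum
  have heq : HasSum (fun m : ℤ => (-1) ^ m * w ^ (9 * m ^ 2 - 6 * m) * x ^ (3 * m)
        - (-1) ^ m * w ^ (9 * m ^ 2 + 6 * m) * x ^ (3 * m + 2)) (∑' j, H1 j - ∑' j, H2 j) := by
    refine (s1'.sub s2.hasSum).congr_fun ?_
    intro m
    simp only [H1, H2, Function.comp, Equiv.neg_apply]
    have hs : (-1 : ℂ) ^ (-m) = (-1) ^ m := by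
      rw [zpow_neg, ← inv_zpow]
      norm_num
    rw [hs, show 9 * (-m) ^ 2 + 6 * -m = 9 * m ^ 2 - 6 * m by ring,
      show -(3 * -m) = 3 * m by ring]
  have hsum : HasSum (fun j => H1 j - H2 j) ((∑' a : ℤ, w ^ (3 * a ^ 2) * x ^ a) *
        ((Phi ((w ^ 6) ^ 2))⁻¹ * ∑' k, t (w ^ 6) (x ^ 2) k)) := by
    rw [hM.unique heq]
    exact s1.hasSum.sub s2.hasSum
  have hterm : ∀ m : ℕ, (H1 m - H2 m) + (H1 (-(m + 1)) - H2 (-(m + 1))) =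
      (-1 : ℂ) ^ m * (w ^ (3 * m * (3 * m + 2)) * (x ^ (-(3 * (m : ℤ))) - x ^ (3 * (m : ℤ) + 2))
        + w ^ (3 * (3 * m + 1) * (m + 1)) *
          (x ^ (-(3 * (m : ℤ)) - 1) - x ^ (3 * (m : ℤ) + 3))) := by
    intro m
    simp only [H1, H2]
    have i1 : (-1 : ℂ) ^ (-((m : ℤ) + 1)) = - (-1) ^ m := by
      rw [zpow_neg, ← inv_zpow, zpow_add₀ (by norm_num)]
      norm_num
    have i2 : w ^ (9 * (m : ℤ) ^ 2 + 6 * m) = w ^ (3 * m * (3 * m + 2)) := by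
      rw [← zpow_natCast]; congr 1; push_cast; ring
    have i3 : w ^ (9 * (-((m : ℤ) + 1)) ^ 2 + 6 * (-((m : ℤ) + 1)))
        = w ^ (3 * (3 * m + 1) * (m + 1)) := by
      rw [← zpow_natCast]; congr 1; push_cast; ring
    rw [i1, i2, i3, zpow_natCast, show -(3 * -((m : ℤ) + 1)) = 3 * m + 3 by ring,
      show 3 * -((m : ℤ) + 1) + 2 = -(3 * m) - 1 by ring]
    ring
  constructor
  · have hN : Summable (fun j => ‖H1 j - H2 j‖) :=
      (n1.add n2).of_nonneg_of_le (fun _ => norm_nonneg _) fun j => norm_sub_le _ _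
    refine hN.hasSum.nat_add_neg_add_one.summable.of_nonneg_of_le (fun _ => norm_nonneg _)
      fun m => ?_
    rw [← hterm]
    exact norm_add_le _ _
  · have := hsum.nat_add_neg_add_one
    exact this.congr_fun fun m => (hterm m).symm

end ThetaHermite

theorem theta_hermite_weight_expansion (w x : ℂ) (hw0 : 0 < ‖w‖) (hw1 : ‖w‖ < 1)
    (hx : x ≠ 0) :
    Summable (fun a : ℤ => ‖w ^ (3 * a ^ 2) * x ^ a‖) ∧
    Multipliable (fun j : ℕ =>
      (1 - w ^ (12 * j) * x ^ 2) * (1 - w ^ (12 * j + 12) * x ^ (-2 : ℤ))) ∧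
    Summable (fun m : ℕ =>
      ‖(-1 : ℂ) ^ m * (w ^ (3 * m * (3 * m + 2)) * (x ^ (-(3 * (m : ℤ))) - x ^ (3 * (m : ℤ) + 2))
        + w ^ (3 * (3 * m + 1) * (m + 1)) * (x ^ (-(3 * (m : ℤ)) - 1) - x ^ (3 * (m : ℤ) + 3)))‖) ∧
    (∑' a : ℤ, w ^ (3 * a ^ 2) * x ^ a) *
      (∏' j : ℕ, (1 - w ^ (12 * j) * x ^ 2) * (1 - w ^ (12 * j + 12) * x ^ (-2 : ℤ)))
    = ∑' m : ℕ,
        (-1 : ℂ) ^ m * (w ^ (3 * m * (3 * m + 2)) * (x ^ (-(3 * (m : ℤ))) - x ^ (3 * (m : ℤ) + 2))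
          + w ^ (3 * (3 * m + 1) * (m + 1)) * (x ^ (-(3 * (m : ℤ)) - 1) - x ^ (3 * (m : ℤ) + 3))) := by
  have hw : w ≠ 0 := norm_pos_iff.mp hw0
  have hn : ∀ m ≠ 0, ‖w ^ m‖ < 1 := fun m hm => by
    rw [norm_pow]; exact pow_lt_one₀ (norm_nonneg _) hw1 hm
  have hmul : Multipliable (fun j : ℕ =>
      (1 - w ^ (12 * j) * x ^ 2) * (1 - w ^ (12 * j + 12) * x ^ (-2 : ℤ))) := by
    have h := (ThetaHermite.multipliable_pow (w ^ 12) (x ^ 2) (hn 12 (by norm_num)) 0).mul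
      (ThetaHermite.multipliable_pow (w ^ 12) (x ^ (-2 : ℤ)) (hn 12 (by norm_num)) 1)
    simpa only [← pow_mul, mul_add, add_zero, mul_one] using h
  obtain ⟨hs, hS⟩ := ThetaHermite.final_hasSum w x hw hw1 hx
  refine ⟨ThetaHermite.summable_theta w x hw hw1 hx, hmul, hs, ?_⟩
  rw [hS.tsum_eq]
  congr 1
  refine tendsto_nhds_unique hmul.tendsto_prod_tprod_nat ?_
  refine (ThetaHermite.triple (w ^ 6) (x ^ 2) (pow_ne_zero _ hw) (hn 6 (by norm_num))
    (pow_ne_zero _ hx)).congr fun n => ?_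
  refine Finset.prod_congr rfl fun j _ => ?_
  rw [zpow_neg, zpow_ofNat]
  ring
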